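/- Let ξ = (L_α, ξ_α^β, Λ, L) be a finite complete projective system of vector spaces with dim L = n. Then there exist a multifoliate structure (Λ',p') on {1,…,n} and a linear isomorphism φ : L → ℝ^n such that f ↦ φ ∘ f ∘ φ⁻¹ maps GL(ξ) bijectively onto GL(Λ',p'); in particular, every finite complete projective system is equivalent to the completed system ξ̃(Λ',p') of some multifoliate structure. -/

import Mathlib

/-! Common definitions: projective systems of finite-dimensional real vector
spaces over a poset, their limits, the groups `GL(ξ)`, invariant subspaces,
completeness, completions, and multifoliate structures. -/

structure ProjSys (Λ : Type) [PartialOrder Λ] where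
  L : Λ → Type
  [instAddCommGroup : ∀ α, AddCommGroup (L α)]
  [instModule : ∀ α, Module ℝ (L α)]
  [instFiniteDimensional : ∀ α, FiniteDimensional ℝ (L α)]
  map : ∀ {α β : Λ}, α ≤ β → (L β →ₗ[ℝ] L α)
  map_id : ∀ α : Λ, map (le_refl α) = LinearMap.id
  map_comp : ∀ {α β γ : Λ} (h₁ : α ≤ β) (h₂ : β ≤ γ),
    (map h₁).comp (map h₂) = map (h₁.trans h₂)
  map_surj : ∀ {α β : Λ} (h : α ≤ β), Function.Surjective (map h)

attribute [instance] ProjSys.instAddCommGroup ProjSys.instModule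
  ProjSys.instFiniteDimensional

namespace ProjSys

variable {Λ : Type} [PartialOrder Λ]

/-- The limit of a projective system, as a submodule of the product. -/
def limSub (ξ : ProjSys Λ) : Submodule ℝ (∀ α, ξ.L α) where
  carrier := {x | ∀ (α β : Λ) (h : α ≤ β), ξ.map h (x β) = x α}
  add_mem' := by
    intro a b ha hb α β h
    simp only [Pi.add_apply, map_add, ha α β h, hb α β h]
  zero_mem' := by
    intro α β h
    simp only [Pi.zero_apply, map_zero]
  smul_mem' := by
    intro c a ha α β h
    simp only [Pi.smul_apply, map_smul, ha α β h]

/-- The canonical projection from the limit to the `α`-th space. -/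
def proj (ξ : ProjSys Λ) (α : Λ) : ↥ξ.limSub →ₗ[ℝ] ξ.L α :=
  (LinearMap.proj α : (∀ β, ξ.L β) →ₗ[ℝ] ξ.L α).comp ξ.limSub.subtype

/-- `GL(ξ)`: the linear automorphisms of the limit that cover automorphisms
of every space of the system. -/
def GLset (ξ : ProjSys Λ) : Set (↥ξ.limSub ≃ₗ[ℝ] ↥ξ.limSub) :=
  {f | ∀ α : Λ, ∃ fα : ξ.L α ≃ₗ[ℝ] ξ.L α,
    ∀ x : ↥ξ.limSub, ξ.proj α (f x) = fα (ξ.proj α x)}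

/-- A subspace of the limit is invariant if every element of `GL(ξ)`
maps it into itself. -/
def Invariant (ξ : ProjSys Λ) (K : Submodule ℝ ↥ξ.limSub) : Prop :=
  ∀ f ∈ ξ.GLset, ∀ x ∈ K, f x ∈ K

/-- A projective system is complete if every finite-codimensional invariant
subspace of the limit is the kernel of some canonical projection. -/
def Complete (ξ : ProjSys Λ) : Prop :=
  ∀ K : Submodule ℝ ↥ξ.limSub, ξ.Invariant K →
    FiniteDimensional ℝ (↥ξ.limSub ⧸ K) → ∃ α : Λ, K = LinearMap.ker (ξ.proj α)

/-- The index set of the completion: all finite-codimensional invariant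
subspaces, ordered by reverse inclusion. -/
def CompletionIndex (ξ : ProjSys Λ) : Type :=
  {K : Submodule ℝ ↥ξ.limSub //
    ξ.Invariant K ∧ FiniteDimensional ℝ (↥ξ.limSub ⧸ K)}

instance (ξ : ProjSys Λ) : PartialOrder ξ.CompletionIndex :=
  PartialOrder.lift (fun a => OrderDual.toDual a.1)
    (fun _ _ h => Subtype.ext (congrArg OrderDual.ofDual h))

/-- The completion of a projective system: the quotients by all
finite-codimensional invariant subspaces, with the canonical epimorphisms. -/
noncomputable def completion (ξ : ProjSys Λ) : ProjSys ξ.CompletionIndex where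
  L a := ↥ξ.limSub ⧸ a.1
  instAddCommGroup := fun _ => inferInstance
  instModule := fun _ => inferInstance
  instFiniteDimensional := fun a => a.2.2
  map := fun {a b} h => Submodule.mapQ b.1 a.1 LinearMap.id
    (by rw [Submodule.comap_id]; exact h)
  map_id := by
    intro a
    apply Submodule.linearMap_qext
    ext x
    simp [Submodule.mapQ_apply]
  map_comp := by
    intro a b c h₁ h₂
    apply Submodule.linearMap_qext
    ext x
    simp [Submodule.mapQ_apply]
  map_surj := by
    intro a b h y
    obtain ⟨x, rfl⟩ := Submodule.Quotient.mk_surjective _ y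
    exact ⟨Submodule.Quotient.mk x, by simp [Submodule.mapQ_apply]⟩

/-- An isomorphism of projective systems: an order isomorphism of the index
sets together with compatible linear isomorphisms of the spaces. -/
def Isomorphic {Λ' : Type} [PartialOrder Λ'] (ξ : ProjSys Λ)
    (ξ' : ProjSys Λ') : Prop :=
  ∃ ω : Λ ≃o Λ', ∃ ψ : ∀ α : Λ, ξ.L α ≃ₗ[ℝ] ξ'.L (ω α),
    ∀ (α β : Λ) (h : α ≤ β) (x : ξ.L β),
      ξ'.map (ω.monotone h) (ψ β x) = ψ α (ξ.map h x)

/-- Equivalence of projective systems: a linear isomorphism of the limits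
conjugating `GL(ξ)` onto `GL(ξ')` (such a conjugation is automatically a
group isomorphism). -/
def Equivalent {Λ' : Type} [PartialOrder Λ'] (ξ : ProjSys Λ)
    (ξ' : ProjSys Λ') : Prop :=
  ∃ φ : ↥ξ.limSub ≃ₗ[ℝ] ↥ξ'.limSub,
    Set.BijOn (fun f => (φ.symm.trans f).trans φ) ξ.GLset ξ'.GLset

end ProjSys

/-- `GL(Λ,p)` for a multifoliate structure `(Λ,p)` on `{1,…,n}`: the linear
automorphisms `f` of `ℝⁿ` whose matrix entries `f i j = f(e_j) i` vanish
whenever `p i ≱ p j`. -/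
def GLmf {n : ℕ} {Λ : Type} [PartialOrder Λ] (p : Fin n → Λ) :
    Set ((Fin n → ℝ) ≃ₗ[ℝ] (Fin n → ℝ)) :=
  {f | ∀ i j : Fin n, ¬ p j ≤ p i → f (Pi.single j 1) i = 0}

/-- Equivalence of multifoliate structures. -/
def MFEquiv {n : ℕ} {Λ Ω : Type} [PartialOrder Λ] [PartialOrder Ω]
    (p : Fin n → Λ) (q : Fin n → Ω) : Prop :=
  ∃ φ : (Fin n → ℝ) ≃ₗ[ℝ] (Fin n → ℝ),
    Set.BijOn (fun f => (φ.symm.trans f).trans φ) (GLmf p) (GLmf q)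

/-- The projective system `ξ(Λ,p)` associated with a multifoliate structure:
the spaces `L_α = ℝ^{H_α}`, `H_α = {i : p i ≤ α}`, with the coordinate
projections. -/
noncomputable def mfSys {n : ℕ} {Λ : Type} [PartialOrder Λ] (p : Fin n → Λ) : ProjSys Λ where
  L α := {i : Fin n // p i ≤ α} → ℝ
  instAddCommGroup := fun _ => inferInstance
  instModule := fun _ => inferInstance
  instFiniteDimensional := fun _ => inferInstance
  map := fun {α β} h => LinearMap.funLeft ℝ ℝ (fun i => ⟨i.1, i.2.trans h⟩)
  map_id := fun _ => rfl
  map_comp := fun _ _ => rfl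
  map_surj := by
    intro α β h
    apply LinearMap.funLeft_surjective_of_injective
    intro i j hij
    cases i
    cases j
    simpa using hij

/-- `ker pr_α ⊆ ℝⁿ`: the vectors vanishing on all coordinates `i` with
`p i ≤ α`. -/
def kerpr {n : ℕ} {Λ : Type} [PartialOrder Λ] (p : Fin n → Λ) (α : Λ) :
    Submodule ℝ (Fin n → ℝ) where
  carrier := {x | ∀ i : Fin n, p i ≤ α → x i = 0}
  add_mem' := by
    intro a b ha hb i hi
    simp [ha i hi, hb i hi]
  zero_mem' := by
    intro i hi
    rfl
  smul_mem' := by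
    intro c a ha i hi
    simp [ha i hi]

/-- The antichains of a poset, ordered by domination. -/
def AntichainsIn (Λ : Type) [PartialOrder Λ] : Type :=
  {A : Finset Λ // IsAntichain (· ≤ ·) (A : Set Λ)}

instance {Λ : Type} [PartialOrder Λ] : LE (AntichainsIn Λ) :=
  ⟨fun A B => ∀ a ∈ A.1, ∃ b ∈ B.1, a ≤ b⟩

/-- The `GL(Λ,p)`-invariant subspaces of `ℝⁿ`, ordered by reverse
inclusion. -/
def InvariantSubspaces {n : ℕ} {Λ : Type} [PartialOrder Λ]
    (p : Fin n → Λ) : Type :=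
  {K : Submodule ℝ (Fin n → ℝ) // ∀ g ∈ GLmf p, ∀ x ∈ K, g x ∈ K}

instance {n : ℕ} {Λ : Type} [PartialOrder Λ] (p : Fin n → Λ) :
    LE (InvariantSubspaces p) :=
  ⟨fun K K' => K'.1 ≤ K.1⟩

/-- A bundled multifoliate structure on `{1,…,n}`. -/
structure MultifoliateStructure (n : ℕ) where
  Lam : Type
  [instPO : PartialOrder Lam]
  [instFin : Finite Lam]
  p : Fin n → Lam
  surj : Function.Surjective p

attribute [instance] MultifoliateStructure.instPO MultifoliateStructure.instFin

section Abstract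
variable {V : Type} [AddCommGroup V] [Module ℝ V]

/-- Subspaces invariant under a set of automorphisms. -/
def hlpInv (G : Set (V ≃ₗ[ℝ] V)) : Set (Submodule ℝ V) :=
  {K | ∀ f ∈ G, ∀ x ∈ K, f x ∈ K}

theorem hlp_inf {G : Set (V ≃ₗ[ℝ] V)} {A B : Submodule ℝ V} (hA : A ∈ hlpInv G)
    (hB : B ∈ hlpInv G) : A ⊓ B ∈ hlpInv G :=
  fun f hf x hx => ⟨hA f hf x hx.1, hB f hf x hx.2⟩

theorem hlp_sSup {G : Set (V ≃ₗ[ℝ] V)} {T : Set (Submodule ℝ V)} (hT : T ⊆ hlpInv G) :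
    sSup T ∈ hlpInv G := by
  intro f hf
  have : sSup T ≤ (sSup T).comap (f : V →ₗ[ℝ] V) := by
    apply sSup_le
    intro K hK x hx
    exact (le_sSup hK : K ≤ sSup T) (hT hK f hf x hx)
  exact fun x hx => this hx

theorem hlp_sInf {G : Set (V ≃ₗ[ℝ] V)} {T : Set (Submodule ℝ V)} (hT : T ⊆ hlpInv G) :
    sInf T ∈ hlpInv G := by
  intro f hf x hx
  rw [Submodule.mem_sInf] at hx ⊢
  exact fun K hK => hT hK f hf x (hx K hK)

theorem hlp_top {G : Set (V ≃ₗ[ℝ] V)} : (⊤ : Submodule ℝ V) ∈ hlpInv G :=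
  fun _ _ _ _ => trivial

/-- The auxiliary one-parameter family of subspaces. -/
def hlpX (A B C : Submodule ℝ V) (t : ℝ) : Submodule ℝ V where
  carrier := {x | ∃ b ∈ B, ∃ c ∈ C, b + c ∈ A ∧ x = b + t • c}
  add_mem' := by
    rintro _ _ ⟨b, hb, c, hc, h, rfl⟩ ⟨b', hb', c', hc', h', rfl⟩
    refine ⟨b + b', B.add_mem hb hb', c + c', C.add_mem hc hc', ?_, by module⟩
    convert A.add_mem h h' using 1
    abel
  zero_mem' := ⟨0, B.zero_mem, 0, C.zero_mem, by simp, by simp⟩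
  smul_mem' := by
    rintro r _ ⟨b, hb, c, hc, h, rfl⟩
    refine ⟨r • b, B.smul_mem r hb, r • c, C.smul_mem r hc, ?_, by module⟩
    convert A.smul_mem r h using 1
    module

theorem hlp_distrib {G : Set (V ≃ₗ[ℝ] V)} (hfin : (hlpInv G).Finite) {A B C : Submodule ℝ V}
    (hA : A ∈ hlpInv G) (hB : B ∈ hlpInv G) (hC : C ∈ hlpInv G) :
    A ⊓ (B ⊔ C) ≤ A ⊓ B ⊔ A ⊓ C := by
  have hX : ∀ t, hlpX A B C t ∈ hlpInv G := by
    rintro t f hf _ ⟨b, hb, c, hc, h, rfl⟩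
    refine ⟨f b, hB f hf b hb, f c, hC f hf c hc, ?_, by simp⟩
    rw [← map_add]
    exact hA f hf _ h
  obtain ⟨s, -, t, -, hst, hE⟩ := Set.infinite_univ.exists_ne_map_eq_of_mapsTo
    (s := (Set.univ : Set ℝ)) (f := hlpX A B C) (fun t _ => hX t) hfin
  rintro a ⟨haA, ha⟩
  obtain ⟨b, hb, c, hc, rfl⟩ := Submodule.mem_sup.1 ha
  have h1 : b + s • c ∈ hlpX A B C t := by
    rw [← hE]
    exact ⟨b, hb, c, hc, haA, rfl⟩
  obtain ⟨b', hb', c', hc', h', e⟩ := h1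
  have hst' : s - t ≠ 0 := sub_ne_zero.2 hst
  have e2 : b - b' = t • c' - s • c := by
    have := congrArg (fun z => z - b' - s • c) e
    rw [show b - b' = b + s • c - b' - s • c by abel, this]
    abel
  have heB : b - b' ∈ B := B.sub_mem hb hb'
  have heC : b - b' ∈ C := by
    rw [e2]
    exact C.sub_mem (C.smul_mem _ hc') (C.smul_mem _ hc)
  set u := ((1 - t) / (s - t)) • (b - b') with hu
  have huB : u ∈ B := B.smul_mem _ heB
  have huC : u ∈ C := C.smul_mem _ heC
  have hcA : c + u ∈ A := by
    have h3 : (s - t)⁻¹ • (t • (b' + c') - t • (b + c)) ∈ A :=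
      A.smul_mem _ (A.sub_mem (A.smul_mem _ h') (A.smul_mem _ haA))
    convert h3 using 1
    have : t • (b' + c') - t • (b + c) = (s - t) • c + (1 - t) • (b - b') := by
      have h4 : t • c' = b - b' + s • c := by rw [e2]; abel
      rw [smul_add t b' c', h4]
      module
    rw [this, smul_add, smul_smul, inv_mul_cancel₀ hst', one_smul, smul_smul, hu]
    congr 2
    field_simp
  have hbA : b - u ∈ A := by
    have := A.sub_mem haA hcA
    rwa [show b + c - (c + u) = b - u by abel] at this
  refine Submodule.mem_sup.2 ⟨b - u, ⟨hbA, B.sub_mem hb huB⟩, c + u, ⟨hcA, C.add_mem hc huC⟩, ?_⟩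
  abel

theorem hlp_distrib_sup {G : Set (V ≃ₗ[ℝ] V)} (hfin : (hlpInv G).Finite) {A : Submodule ℝ V}
    (hA : A ∈ hlpInv G) {ι : Type} (T : Finset ι) (F : ι → Submodule ℝ V)
    (hF : ∀ i, F i ∈ hlpInv G) :
    A ⊓ T.sup F ≤ T.sup (fun i => A ⊓ F i) := by
  classical
  induction T using Finset.induction_on with
  | empty => simp
  | insert i T hi ih =>
    rw [Finset.sup_insert, Finset.sup_insert]
    refine (hlp_distrib hfin hA (hF i) ?_).trans (sup_le_sup le_rfl ih)
    rw [Finset.sup_eq_sSup_image]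
    apply hlp_sSup
    rintro _ ⟨j, _, rfl⟩
    exact hF j

theorem hlp_basis [FiniteDimensional ℝ V] {G : Set (V ≃ₗ[ℝ] V)} (hfin : (hlpInv G).Finite)
    (n : ℕ) (hn : Module.finrank ℝ V = n) :
    ∃ b : Module.Basis (Fin n) ℝ V, ∀ K ∈ hlpInv G,
      K ≤ Submodule.span ℝ (b '' {i | b i ∈ K}) := by
  classical
  let ι := {K : Submodule ℝ V // K ∈ hlpInv G}
  haveI : Finite ι := hfin
  haveI : Fintype ι := Fintype.ofFinite ι
  let low : ι → Submodule ℝ V := fun K => sSup {K' | K' ∈ hlpInv G ∧ K' < K.1}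
  have hlow : ∀ K : ι, low K ≤ K.1 := fun K => sSup_le fun K' h => h.2.le
  have hex : ∀ K : ι, ∃ C : Submodule ℝ V, low K ⊔ C = K.1 ∧ low K ⊓ C = ⊥ := by
    intro K
    obtain ⟨C, hC⟩ := exists_isCompl (⟨low K, hlow K⟩ : Set.Iic K.1)
    refine ⟨C.1, ?_, ?_⟩
    · simpa using congrArg Subtype.val hC.sup_eq_top
    · simpa using congrArg Subtype.val hC.inf_eq_bot
  choose C hC1 hC2 using hex
  have hCle : ∀ K, C K ≤ K.1 := fun K => (hC1 K) ▸ le_sup_right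
  have hspan : ∀ K : ι, K.1 ≤ ⨆ K' : ι, ⨆ _ : K' ≤ K, C K' := by
    intro K
    induction K using WellFoundedLT.induction with
    | ind K ih =>
      rw [← hC1 K]
      apply sup_le
      · apply sSup_le
        rintro K' ⟨h1, h2⟩
        refine (ih ⟨K', h1⟩ h2).trans ?_
        apply iSup₂_le
        intro K'' h3
        exact le_iSup₂_of_le (f := fun (K' : ι) (_ : K' ≤ K) => C K') K''
          (h3.trans (le_of_lt h2)) le_rfl
      · exact le_iSup₂_of_le (f := fun (K' : ι) (_ : K' ≤ K) => C K') K le_rfl le_rfl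
  have hind : iSupIndep C := by
    rw [iSupIndep_iff_finsetSum_eq_zero_imp_eq_zero]
    intro s v hv hsum
    by_contra! hne
    obtain ⟨K0, hK0, hK0'⟩ := hne
    obtain ⟨K, hK, hmax⟩ := (s.filter (fun K => v K ≠ 0)).exists_maximal
      ⟨K0, Finset.mem_filter.2 ⟨hK0, hK0'⟩⟩
    rw [Finset.mem_filter] at hK
    let T := (s.filter (fun K => v K ≠ 0)).erase K
    have hvK : v K = - ∑ K' ∈ T, v K' := by
      rw [eq_neg_iff_add_eq_zero, Finset.add_sum_erase _ _ (Finset.mem_filter.2 hK),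
        Finset.sum_filter_ne_zero, hsum]
    have hmemT : v K ∈ T.sup (fun K' : ι => K'.1) := by
      rw [hvK]
      apply Submodule.neg_mem
      apply Submodule.sum_mem
      intro K' hK'
      have : K'.1 ≤ T.sup (fun K' : ι => K'.1) :=
        Finset.le_sup (f := fun K' : ι => K'.1) hK'
      exact this (hCle K' (hv K' (Finset.mem_filter.1 (Finset.mem_erase.1 hK').2).1))
    have hmem : v K ∈ K.1 ⊓ T.sup (fun K' : ι => K'.1) := ⟨hCle K (hv K hK.1), hmemT⟩
    have hle : T.sup (fun K' : ι => K.1 ⊓ K'.1) ≤ low K := by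
      apply Finset.sup_le
      intro K' hK'
      apply le_sSup
      refine ⟨hlp_inf K.2 K'.2, lt_of_le_of_ne inf_le_left ?_⟩
      intro he
      have hle : K ≤ K' := inf_eq_left.1 he
      have := hmax (Finset.mem_erase.1 hK').2 hle
      exact (Finset.mem_erase.1 hK').1 (le_antisymm this hle)
    have h0 : v K ∈ low K ⊓ C K :=
      ⟨hle (hlp_distrib_sup hfin K.2 T (fun K' : ι => K'.1) (fun i => i.2) hmem), hv K hK.1⟩
    rw [hC2] at h0
    exact hK.2 h0
  have htop : iSup C = ⊤ := by
    rw [eq_top_iff]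
    refine (hspan ⟨⊤, hlp_top⟩).trans ?_
    exact iSup₂_le fun K' _ => le_iSup C K'
  have hint := DirectSum.isInternal_submodule_of_iSupIndep_of_iSup_eq_top hind htop
  let b0 := hint.collectedBasis (fun K => Module.finBasis ℝ (C K))
  have hcard : Fintype.card (Σ K : ι, Fin (Module.finrank ℝ (C K))) = n := by
    rw [← Module.finrank_eq_card_basis b0, hn]
  let e := Fintype.equivFinOfCardEq hcard
  refine ⟨b0.reindex e, fun K hK => ?_⟩
  refine (hspan ⟨K, hK⟩).trans (iSup₂_le fun K' hK' => ?_)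
  have : C K' = Submodule.span ℝ (Set.range fun j => ((Module.finBasis ℝ (C K') j : C K') : V)) := by
    have h := congrArg (Submodule.map (C K').subtype) (Module.finBasis ℝ (C K')).span_eq
    rw [Submodule.map_span, ← Set.range_comp] at h
    rw [Submodule.map_top, Submodule.range_subtype] at h
    exact h.symm
  rw [this]
  apply Submodule.span_mono
  rintro _ ⟨j, rfl⟩
  have hb : b0.reindex e (e ⟨K', j⟩) = (Module.finBasis ℝ (C K') j : C K') := by
    rw [Module.Basis.reindex_apply, Equiv.symm_apply_apply]
    simp [b0, DirectSum.IsInternal.collectedBasis_coe]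
  refine ⟨e ⟨K', j⟩, ?_, hb⟩
  change b0.reindex e (e ⟨K', j⟩) ∈ K
  rw [hb]
  exact hK' (hCle K' (Submodule.coe_mem _))

theorem hlp_main [FiniteDimensional ℝ V] {G : Set (V ≃ₗ[ℝ] V)} (hfin : (hlpInv G).Finite)
    (hG : ∀ f : V ≃ₗ[ℝ] V, (∀ K ∈ hlpInv G, ∀ x ∈ K, f x ∈ K) → f ∈ G)
    (n : ℕ) (hn : Module.finrank ℝ V = n) :
    ∃ M : MultifoliateStructure n, ∃ φ : V ≃ₗ[ℝ] (Fin n → ℝ),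
      ∀ f, f ∈ G ↔ (φ.symm.trans f).trans φ ∈ GLmf M.p := by
  obtain ⟨b, hb⟩ := hlp_basis hfin n hn
  let k : Fin n → Submodule ℝ V := fun j => sInf {K | K ∈ hlpInv G ∧ b j ∈ K}
  have hk : ∀ j, k j ∈ hlpInv G := fun j => hlp_sInf fun K h => h.1
  have hbk : ∀ j, b j ∈ k j := fun j => Submodule.mem_sInf.2 fun K h => h.2
  have hkle : ∀ j, ∀ K ∈ hlpInv G, b j ∈ K → k j ≤ K := fun j K h1 h2 => sInf_le ⟨h1, h2⟩
  have hmem : ∀ K ∈ hlpInv G, ∀ x, x ∈ K ↔ ∀ i, b i ∉ K → b.repr x i = 0 := by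
    intro K hK x
    constructor
    · intro hx i hi
      have := (b.mem_span_image).1 (hb K hK hx)
      by_contra h
      exact hi (this (Finsupp.mem_support_iff.2 h))
    · intro h
      rw [← b.sum_repr x]
      refine Submodule.sum_mem _ fun i _ => ?_
      by_cases hi : b i ∈ K
      · exact K.smul_mem _ hi
      · rw [h i hi, zero_smul]
        exact K.zero_mem
  let q : Fin n → (Submodule ℝ V)ᵒᵈ := fun j => OrderDual.toDual (k j)
  refine ⟨{ Lam := Set.range q, instFin := Set.finite_range q, p := Set.rangeFactorization q,
            surj := Set.rangeFactorization_surjective }, b.equivFun, fun f => ?_⟩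
  have h1 : f ∈ G ↔ ∀ j, f (b j) ∈ k j := by
    constructor
    · exact fun hf j => hk j f hf _ (hbk j)
    · intro h
      apply hG
      intro K hK
      have : K ≤ K.comap (f : V →ₗ[ℝ] V) := by
        refine (hb K hK).trans (Submodule.span_le.2 ?_)
        rintro _ ⟨i, hi, rfl⟩
        exact hkle i K hK hi (h i)
      exact fun x hx => this hx
  have h2 : ∀ i j, (Set.rangeFactorization q j ≤ Set.rangeFactorization q i) ↔ b i ∈ k j := by
    intro i j
    change k i ≤ k j ↔ _
    exact ⟨fun h => h (hbk i), hkle i _ (hk j)⟩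
  rw [h1]
  simp only [GLmf, Set.mem_setOf_eq, h2]
  have h3 : ∀ i j, ((b.equivFun.symm.trans f).trans b.equivFun) (Pi.single j 1) i
      = b.repr (f (b j)) i := by
    intro i j
    simp [Module.Basis.equivFun_symm_apply, Pi.single_apply]
  simp only [h3]
  rw [forall_comm]
  exact forall_congr' fun j => hmem _ (hk j) _

theorem hlp_bijOn {W : Type} [AddCommGroup W] [Module ℝ W] (φ : V ≃ₗ[ℝ] W)
    {A : Set (V ≃ₗ[ℝ] V)} {B : Set (W ≃ₗ[ℝ] W)}
    (h : ∀ f, f ∈ A ↔ (φ.symm.trans f).trans φ ∈ B) :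
    Set.BijOn (fun f : V ≃ₗ[ℝ] V => (φ.symm.trans f).trans φ) A B := by
  refine ⟨fun f hf => (h f).1 hf, ?_, ?_⟩
  · intro f _ g _ hfg
    ext x
    have := LinearEquiv.congr_fun hfg (φ x)
    simpa using this
  · intro g hg
    have e : (φ.symm.trans ((φ.trans g).trans φ.symm)).trans φ = g := by
      ext x
      simp
    refine ⟨(φ.trans g).trans φ.symm, ?_, e⟩
    rw [h, e]
    exact hg

end Abstract

theorem hlp_glset_iff {Λ : Type} [PartialOrder Λ] (ξ : ProjSys Λ)
    (hsurj : ∀ α : Λ, Function.Surjective (ξ.proj α)) (f : ↥ξ.limSub ≃ₗ[ℝ] ↥ξ.limSub) :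
    f ∈ ξ.GLset ↔ ∀ α x, ξ.proj α x = 0 → ξ.proj α (f x) = 0 := by
  constructor
  · intro h α x hx
    obtain ⟨g, hg⟩ := h α
    rw [hg, hx, map_zero]
  · intro h α
    obtain ⟨s, hs⟩ := (ξ.proj α).exists_rightInverse_of_surjective
      (LinearMap.range_eq_top.2 (hsurj α))
    let g : ξ.L α →ₗ[ℝ] ξ.L α := (ξ.proj α) ∘ₗ (f : ↥ξ.limSub →ₗ[ℝ] ↥ξ.limSub) ∘ₗ s
    have hg : ∀ x, ξ.proj α (f x) = g (ξ.proj α x) := by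
      intro x
      have h1 : ξ.proj α (x - s (ξ.proj α x)) = 0 := by
        rw [map_sub, sub_eq_zero]
        exact (LinearMap.congr_fun hs (ξ.proj α x)).symm
      have h2 := h α _ h1
      rw [map_sub, map_sub, sub_eq_zero] at h2
      exact h2
    have hgs : Function.Surjective g := by
      intro y
      obtain ⟨x, rfl⟩ := hsurj α y
      exact ⟨ξ.proj α (f.symm x), by rw [← hg, f.apply_symm_apply]⟩
    exact ⟨LinearEquiv.ofBijective g ⟨LinearMap.injective_iff_surjective.2 hgs, hgs⟩, hg⟩

theorem hlp_completion {Λ : Type} [PartialOrder Λ] (ξ : ProjSys Λ)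
    (hsurj : ∀ α : Λ, Function.Surjective (ξ.proj α)) [FiniteDimensional ℝ ↥ξ.limSub] :
    ∃ φ : ↥ξ.limSub ≃ₗ[ℝ] ↥ξ.completion.limSub,
      ∀ f, f ∈ ξ.GLset ↔ (φ.symm.trans f).trans φ ∈ ξ.completion.GLset := by
  let φ0 : ↥ξ.limSub →ₗ[ℝ] ↥ξ.completion.limSub :=
    { toFun := fun x => ⟨fun K => (Submodule.Quotient.mk x : ↥ξ.limSub ⧸ K.1), by
        intro a b h
        rfl⟩
      map_add' := fun x y => rfl
      map_smul' := fun c x => rfl }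
  have hφ0 : ∀ (K : ξ.CompletionIndex) x, ξ.completion.proj K (φ0 x) =
    (Submodule.Quotient.mk x : ↥ξ.limSub ⧸ K.1) := fun _ _ => rfl
  let bt : ξ.CompletionIndex := ⟨⊥, fun f hf x hx => by
    rw [Submodule.mem_bot] at hx ⊢
    rw [hx, map_zero], inferInstance⟩
  have hinj : Function.Injective φ0 := by
    rw [injective_iff_map_eq_zero]
    intro x hx
    have := hφ0 bt x
    rw [hx, map_zero] at this
    exact (Submodule.mem_bot ℝ).1 ((Submodule.Quotient.mk_eq_zero _).1 this.symm)
  have hsur : Function.Surjective φ0 := by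
    intro y
    obtain ⟨x, hx⟩ := Submodule.Quotient.mk_surjective _ (y.1 bt)
    refine ⟨x, Subtype.ext (funext fun K => ?_)⟩
    have hK : K ≤ bt := (bot_le : (⊥ : Submodule ℝ ↥ξ.limSub) ≤ K.1)
    rw [← y.2 K bt hK, ← hx]
    rfl
  let φ := LinearEquiv.ofBijective φ0 ⟨hinj, hsur⟩
  have hs' : ∀ K, Function.Surjective (ξ.completion.proj K) := by
    intro K y
    obtain ⟨x, hx⟩ := Submodule.Quotient.mk_surjective _ y
    exact ⟨φ0 x, hx⟩
  have h0 : ∀ (K : ξ.CompletionIndex) x, ξ.completion.proj K (φ x) = 0 ↔ x ∈ K.1 :=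
    fun K x => Submodule.Quotient.mk_eq_zero _
  refine ⟨φ, fun f => ?_⟩
  rw [hlp_glset_iff _ hs']
  constructor
  · intro hf K y hy
    obtain ⟨x, rfl⟩ := φ.surjective y
    rw [h0] at hy
    simp only [LinearEquiv.trans_apply, LinearEquiv.symm_apply_apply]
    rw [h0]
    exact K.2.1 f hf x hy
  · intro h
    rw [hlp_glset_iff _ hsurj]
    intro α x hx
    let K : ξ.CompletionIndex := ⟨LinearMap.ker (ξ.proj α), fun g hg x hx =>
      (hlp_glset_iff ξ hsurj g).1 hg α x hx, inferInstance⟩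
    have h1 := h K (φ x) ((h0 K x).2 hx)
    simp only [LinearEquiv.trans_apply, LinearEquiv.symm_apply_apply] at h1
    exact (h0 K _).1 h1

theorem hlp_mf {n : ℕ} {Λ : Type} [PartialOrder Λ] (p : Fin n → Λ) :
    (∀ α, Function.Surjective ((mfSys p).proj α)) ∧
    ∃ φ : (Fin n → ℝ) ≃ₗ[ℝ] ↥(mfSys p).limSub,
      ∀ f, f ∈ GLmf p ↔ (φ.symm.trans f).trans φ ∈ (mfSys p).GLset := by
  let φ0 : (Fin n → ℝ) →ₗ[ℝ] ↥(mfSys p).limSub :=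
    { toFun := fun x => ⟨fun α => (fun i => x i.1 : {i : Fin n // p i ≤ α} → ℝ), by
        intro a b h
        rfl⟩
      map_add' := fun x y => rfl
      map_smul' := fun c x => rfl }
  have hinj : Function.Injective φ0 := by
    intro x y hxy
    funext i
    have h1 := congrFun (congrArg Subtype.val hxy) (p i)
    exact congrFun h1 (⟨i, le_rfl⟩ : {j : Fin n // p j ≤ p i})
  have hsur : Function.Surjective φ0 := by
    intro y
    let y' : ∀ α, {i : Fin n // p i ≤ α} → ℝ := y.1
    refine ⟨fun i => y' (p i) ⟨i, le_rfl⟩, Subtype.ext (funext fun α => ?_)⟩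
    refine funext fun (i : {i : Fin n // p i ≤ α}) => ?_
    exact (congrFun (y.2 (p i.1) α i.2) (⟨i.1, le_rfl⟩ : {j : Fin n // p j ≤ p i.1})).symm
  let φ := LinearEquiv.ofBijective φ0 ⟨hinj, hsur⟩
  have hs : ∀ α, Function.Surjective ((mfSys p).proj α) := by
    intro α y
    classical
    let y' : {i : Fin n // p i ≤ α} → ℝ := y
    refine ⟨φ0 fun i => if h : p i ≤ α then y' ⟨i, h⟩ else 0, ?_⟩
    refine funext fun (i : {i : Fin n // p i ≤ α}) => ?_
    exact dif_pos i.2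
  have h0 : ∀ α x, (mfSys p).proj α (φ x) = 0 ↔ ∀ i, p i ≤ α → x i = 0 := by
    intro α x
    constructor
    · intro h i hi
      exact congrFun h (⟨i, hi⟩ : {i : Fin n // p i ≤ α})
    · intro h
      exact funext fun (i : {i : Fin n // p i ≤ α}) => h i.1 i.2
  refine ⟨hs, φ, fun f => ?_⟩
  rw [hlp_glset_iff _ hs]
  constructor
  · intro hf α y hy
    obtain ⟨x, rfl⟩ := φ.surjective y
    rw [h0] at hy
    simp only [LinearEquiv.trans_apply, LinearEquiv.symm_apply_apply]
    rw [h0]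
    intro i hi
    rw [pi_eq_sum_univ' x, map_sum, Finset.sum_apply]
    refine Finset.sum_eq_zero fun j _ => ?_
    rw [map_smul, Pi.smul_apply]
    by_cases hj : p j ≤ α
    · rw [hy j hj, zero_smul]
    · have h5 := hf i j (fun h => hj (h.trans hi))
      rw [h5, smul_zero]
  · intro h i j hij
    have h1 := h (p i) (φ (Pi.single j 1)) ((h0 _ _).2 fun k hk => by
      rw [Pi.single_apply, if_neg]
      rintro rfl
      exact hij hk)
    simp only [LinearEquiv.trans_apply, LinearEquiv.symm_apply_apply] at h1
    exact (h0 _ _).1 h1 i le_rfl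

/-- Every finite complete projective system with
`n`-dimensional limit comes, up to conjugation by a linear isomorphism
`L ≃ ℝⁿ`, from a multifoliate structure on `{1,…,n}`; in particular it is
equivalent to the completed system of that multifoliate structure. -/
theorem stmt_10 {Λ : Type} [PartialOrder Λ] [Finite Λ] (ξ : ProjSys Λ)
    (hsurj : ∀ α : Λ, Function.Surjective (ξ.proj α))
    (hc : ξ.Complete)
    (n : ℕ) (hn : Module.finrank ℝ ↥ξ.limSub = n) :
    ∃ M : MultifoliateStructure n,
      ∃ φ : ↥ξ.limSub ≃ₗ[ℝ] (Fin n → ℝ),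
        Set.BijOn (fun f => (φ.symm.trans f).trans φ) ξ.GLset (GLmf M.p) ∧
        ξ.Equivalent (mfSys M.p).completion := by
  classical
  have hfd : FiniteDimensional ℝ ↥ξ.limSub := inferInstance
  have hfin : (hlpInv ξ.GLset).Finite := by
    refine (Set.finite_range fun α => LinearMap.ker (ξ.proj α)).subset ?_
    intro K hK
    obtain ⟨α, h⟩ := hc K hK inferInstance
    exact ⟨α, h.symm⟩
  obtain ⟨M, φ, hφ⟩ := hlp_main hfin (fun f hf => by
    rw [hlp_glset_iff _ hsurj]
    intro α x hx
    exact hf (LinearMap.ker (ξ.proj α))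
      (fun g hg x hx => (hlp_glset_iff ξ hsurj g).1 hg α x hx) x hx) n hn
  refine ⟨M, φ, hlp_bijOn φ hφ, ?_⟩
  obtain ⟨hs, φ₁, hφ₁⟩ := hlp_mf M.p
  haveI : FiniteDimensional ℝ ↥(mfSys M.p).limSub := φ₁.finiteDimensional
  obtain ⟨φ₂, hφ₂⟩ := hlp_completion (mfSys M.p) hs
  refine ⟨(φ.trans φ₁).trans φ₂, hlp_bijOn _ fun f => ?_⟩
  rw [hφ, hφ₁, hφ₂]
  rfl
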